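/- arXiv:1605.04516 — 3 statements merged into one kernel-verified Lean document; each statement's English description precedes it below -/
import Mathlib

section
/- For any positive integers ℓ ≤ n and any subset H ⊆ S_n, the subgroup of S_ℓ generated by the ℓ-patterns of H equals the subgroup of S_ℓ generated by the ℓ-patterns of the subgroup ⟨H⟩ of S_n generated by H; that is, gPat_ℓ(H) = gPat_ℓ(⟨H⟩). -/
open Equiv Finset Function

/-- `h_I : [ℓ] → [n]`: the increasing enumeration of an `ℓ`-element subset `I ⊆ [n]`,
i.e., the unique order isomorphism `([ℓ], ≤) → (I, ≤)` viewed as a map into `[n]`. -/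
def hmap {ℓ n : ℕ} (I : Finset (Fin n)) (hI : I.card = ℓ) : Fin ℓ → Fin n :=
  fun i => ((I.orderIsoOfFin hI) i : Fin n)

theorem hmap_injective {ℓ n : ℕ} (I : Finset (Fin n)) (hI : I.card = ℓ) :
    Function.Injective (hmap I hI) := fun a b h =>
  (I.orderIsoOfFin hI).injective (Subtype.ext h)

theorem mem_image_iff_perm {n : ℕ} (π : Equiv.Perm (Fin n)) (I : Finset (Fin n)) (a : Fin n) :
    a ∈ I ↔ π a ∈ I.image ⇑π := by
  constructor
  · exact fun h => Finset.mem_image_of_mem _ h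
  · intro h
    obtain ⟨b, hb, hba⟩ := Finset.mem_image.mp h
    rwa [← π.injective hba]

/-- The pattern `π_I := h_{π(I)}⁻¹ ∘ π ∘ h_I ∈ S_ℓ` of `π ∈ S_n` at an `ℓ`-element
subset `I ⊆ [n]`. -/
def patt {ℓ n : ℕ} (π : Equiv.Perm (Fin n)) (I : Finset (Fin n)) (hI : I.card = ℓ) :
    Equiv.Perm (Fin ℓ) :=
  (I.orderIsoOfFin hI).toEquiv.trans
    ((π.subtypeEquiv (mem_image_iff_perm π I)).trans
      ((I.image ⇑π).orderIsoOfFin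
        (by rw [Finset.card_image_of_injective _ π.injective, hI])).toEquiv.symm)

/-- `Pat_ℓ(π)`: the set of `ℓ`-patterns of `π ∈ S_n`. -/
def PattSet (ℓ : ℕ) {n : ℕ} (π : Equiv.Perm (Fin n)) : Set (Equiv.Perm (Fin ℓ)) :=
  {σ | ∃ (I : Finset (Fin n)) (hI : I.card = ℓ), σ = patt π I hI}

/-- `Comp^n(S)`: the set of `n`-permutations all of whose `ℓ`-patterns lie in `S`. -/
def CompSet (n : ℕ) {ℓ : ℕ} (S : Set (Equiv.Perm (Fin ℓ))) : Set (Equiv.Perm (Fin n)) :=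
  {τ | PattSet ℓ τ ⊆ S}

/-- Pattern involvement: `σ ≤ π` iff `σ = π_I` for some `ℓ`-element subset `I`. -/
def Involves {ℓ n : ℕ} (σ : Equiv.Perm (Fin ℓ)) (π : Equiv.Perm (Fin n)) : Prop :=
  σ ∈ PattSet ℓ π

/-- `gPat_ℓ(H)`: the subgroup of `S_ℓ` generated by the `ℓ`-patterns of members of `H`. -/
def gPat (ℓ : ℕ) {n : ℕ} (H : Set (Equiv.Perm (Fin n))) : Subgroup (Equiv.Perm (Fin ℓ)) :=
  Subgroup.closure (⋃ τ ∈ H, PattSet ℓ τ)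

/-- A function preserves a `k`-ary relation (componentwise application keeps tuples in
the relation). -/
def Preserves {α : Type*} {k : ℕ} (f : α → α) (ρ : Set (Fin k → α)) : Prop :=
  ∀ r ∈ ρ, (f ∘ r) ∈ ρ

/-- The `ℓ`-orbit `a^H = {σ ∘ a : σ ∈ H}`. -/
def orbitRel {ℓ n : ℕ} (H : Subgroup (Equiv.Perm (Fin n))) (a : Fin ℓ → Fin n) :
    Set (Fin ℓ → Fin n) :=
  {x | ∃ σ ∈ H, x = ⇑σ ∘ a}

/-- The reduction `red(u) = h_{range u}⁻¹ ∘ u` of a tuple with pairwise distinct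
entries. -/
def red {k n : ℕ} (u : Fin k → Fin n) (hu : Function.Injective u) : Fin k → Fin k :=
  fun i =>
    ((Finset.univ.image u).orderIsoOfFin
      (by rw [Finset.card_image_of_injective _ hu]; simp)).symm
      ⟨u i, Finset.mem_image_of_mem _ (Finset.mem_univ i)⟩

/-- `red(ρ) = {red(r) : r ∈ ρ}` for a set `ρ` of tuples with pairwise distinct entries. -/
def redSet {k n : ℕ} (ρ : Set (Fin k → Fin n)) : Set (Fin k → Fin k) :=
  {v | ∃ (r : Fin k → Fin n) (_ : r ∈ ρ) (hr : Function.Injective r), v = red r hr}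

/-- `ρ̌ := {h_I⁻¹ ∘ r : r ∈ ρ, range r ⊆ I, I an ℓ-element subset of [n]}`. -/
def checkRel (ℓ : ℕ) {k n : ℕ} (ρ : Set (Fin k → Fin n)) : Set (Fin k → Fin ℓ) :=
  {s | ∃ (r : Fin k → Fin n) (_ : r ∈ ρ) (I : Finset (Fin n)) (hI : I.card = ℓ)
        (hr : ∀ j, r j ∈ I), s = fun j => (I.orderIsoOfFin hI).symm ⟨r j, hr j⟩}

/-- `σ̂ := {h_J ∘ s : s ∈ σ, J an ℓ-element subset of [n]}`. -/
def hatRel (n : ℕ) {k ℓ : ℕ} (σ : Set (Fin k → Fin ℓ)) : Set (Fin k → Fin n) :=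
  {r | ∃ (s : Fin k → Fin ℓ) (_ : s ∈ σ) (J : Finset (Fin n)) (hJ : J.card = ℓ),
        r = hmap J hJ ∘ s}

/-- `ρ` is a pattern closed relation (pc-relation): for every `r ∈ ρ` and all
`ℓ`-element subsets `I, J ⊆ [n]` with `range r ⊆ I`, the tuple `h_J ∘ h_I⁻¹ ∘ r`
belongs to `ρ`. -/
def IsPC (ℓ : ℕ) {k n : ℕ} (ρ : Set (Fin k → Fin n)) : Prop :=
  ∀ r ∈ ρ, ∀ (I J : Finset (Fin n)) (hI : I.card = ℓ) (hJ : J.card = ℓ)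
    (hr : ∀ j, r j ∈ I),
    (fun j => hmap J hJ ((I.orderIsoOfFin hI).symm ⟨r j, hr j⟩)) ∈ ρ

theorem hmap_patt {ℓ n : ℕ} (π : Equiv.Perm (Fin n)) (I J : Finset (Fin n)) (hI : I.card = ℓ)
    (hJ : J.card = ℓ) (h : J = I.image π) (i : Fin ℓ) :
    hmap J hJ (patt π I hI i) = π (hmap I hI i) := by
  subst h
  simp [hmap, patt]

/-- A permutation is the pattern of `π` at `I` if it intertwines the enumerations of `I`
and `π(I)`. -/
theorem eq_patt {ℓ n : ℕ} (π : Equiv.Perm (Fin n)) (I J : Finset (Fin n)) (hI : I.card = ℓ)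
    (hJ : J.card = ℓ) (h : J = I.image π) (σ : Equiv.Perm (Fin ℓ))
    (hσ : ∀ i, hmap J hJ (σ i) = π (hmap I hI i)) : patt π I hI = σ := by
  ext1 i
  apply hmap_injective J hJ
  rw [hmap_patt π I J hI hJ h, hσ]

theorem card_image_perm {ℓ n : ℕ} (π : Equiv.Perm (Fin n)) {I : Finset (Fin n)}
    (hI : I.card = ℓ) : (I.image π).card = ℓ := by
  rw [Finset.card_image_of_injective _ π.injective, hI]

theorem patt_one {ℓ n : ℕ} (I : Finset (Fin n)) (hI : I.card = ℓ) :
    patt (1 : Equiv.Perm (Fin n)) I hI = 1 :=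
  eq_patt 1 I I hI hI (by simp) 1 fun _ => rfl

theorem patt_mul {ℓ n : ℕ} (π τ : Equiv.Perm (Fin n)) (I : Finset (Fin n)) (hI : I.card = ℓ) :
    patt (π * τ) I hI = patt π (I.image τ) (card_image_perm τ hI) * patt τ I hI := by
  refine eq_patt _ I ((I.image τ).image π) hI (card_image_perm π (card_image_perm τ hI))
    (by simp [Finset.image_image]) _ fun i => ?_
  rw [Equiv.Perm.mul_apply, hmap_patt π _ _ _ _ rfl, hmap_patt τ _ _ _ _ rfl,
    Equiv.Perm.mul_apply]

theorem patt_inv {ℓ n : ℕ} (π : Equiv.Perm (Fin n)) (I : Finset (Fin n)) (hI : I.card = ℓ) :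
    patt π⁻¹ I hI = (patt π (I.image ⇑π⁻¹) (card_image_perm π⁻¹ hI))⁻¹ := by
  rw [eq_inv_iff_mul_eq_one, ← patt_one (I.image ⇑π⁻¹) (card_image_perm π⁻¹ hI), eq_comm]
  refine eq_patt _ _ _ _ (card_image_perm π⁻¹ hI) (by simp) _ fun i => ?_
  rw [Equiv.Perm.mul_apply, hmap_patt π⁻¹ I _ hI _ rfl,
    hmap_patt π (I.image ⇑π⁻¹) I _ hI (by simp [Finset.image_image])]
  simp

/-- Every pattern of a member of `⟨H⟩` is a product of patterns of members of `H` and their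
inverses. -/
theorem patt_mem_gPat_of_mem_closure {ℓ n : ℕ} {H : Set (Equiv.Perm (Fin n))}
    {π : Equiv.Perm (Fin n)} (hπ : π ∈ Subgroup.closure H) (I : Finset (Fin n))
    (hI : I.card = ℓ) : patt π I hI ∈ gPat ℓ H := by
  induction hπ using Subgroup.closure_induction generalizing I with
  | mem τ hτ => exact Subgroup.subset_closure (Set.mem_biUnion hτ ⟨I, hI, rfl⟩)
  | one => exact patt_one I hI ▸ one_mem _
  | mul π τ _ _ ihπ ihτ => exact patt_mul π τ I hI ▸ mul_mem (ihπ _ _) (ihτ _ _)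
  | inv π _ ih => exact patt_inv π I hI ▸ inv_mem (ih _ _)

/-- Lemma 3.4: `gPat_ℓ(H) = gPat_ℓ(⟨H⟩)` for any subset `H ⊆ S_n`. -/
theorem stmt7 (ℓ n : ℕ) (hℓ : 0 < ℓ) (hn : ℓ ≤ n) (H : Set (Equiv.Perm (Fin n))) :
    gPat ℓ H =
      gPat ℓ ((Subgroup.closure H : Subgroup (Equiv.Perm (Fin n))) :
        Set (Equiv.Perm (Fin n))) := by
  apply le_antisymm
  · exact Subgroup.closure_mono (Set.biUnion_subset_biUnion_left Subgroup.subset_closure)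
  · refine (Subgroup.closure_le _).2 (Set.iUnion₂_subset fun π hπ => ?_)
    rintro _ ⟨I, hI, rfl⟩
    exact patt_mem_gPat_of_mem_closure hπ I hI
end

section
/- Let ℓ ≤ n be positive integers, let H ≤ S_n, and set ρ_I := (h_I)^H for each ℓ-element subset I ⊆ [n]. Then H is of the form H = Comp^n(S) for some subset S ⊆ S_ℓ if and only if both: (a) H = Aut{ρ_I : I an ℓ-element subset of [n]}, and (b) for every x ∈ [n]^n with pairwise distinct entries, if for every ℓ-element subset I ⊆ [n] there exists an ℓ-element subset J ⊆ [n] with red(x∘h_I) ∈ red(ρ_J), then x∘h_I ∈ ρ_I for every ℓ-element subset I ⊆ [n]. -/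
open Equiv Finset Function

theorem image_hmap {ℓ n : ℕ} (I : Finset (Fin n)) (hI : I.card = ℓ) :
    Finset.univ.image (hmap I hI) = I := by
  ext a
  simp only [Finset.mem_image, Finset.mem_univ, true_and]
  constructor
  · rintro ⟨i, rfl⟩
    exact (I.orderIsoOfFin hI i).2
  · intro ha
    exact ⟨(I.orderIsoOfFin hI).symm ⟨a, ha⟩, by simp [hmap]⟩

theorem red_eq_symm_apply {k n : ℕ} (u : Fin k → Fin n) (hu : Function.Injective u)
    (K : Finset (Fin n)) (hK : K.card = k) (h : Finset.univ.image u = K) (i : Fin k)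
    (hi : u i ∈ K) : red u hu i = (K.orderIsoOfFin hK).symm ⟨u i, hi⟩ := by
  subst h
  rfl

/-- The reduction of `π ∘ h_I` is the pattern `π_I`. -/
theorem red_comp_hmap {ℓ n : ℕ} (π : Equiv.Perm (Fin n)) (I : Finset (Fin n)) (hI : I.card = ℓ)
    (u : Fin ℓ → Fin n) (hu : Function.Injective u) (h : u = ⇑π ∘ hmap I hI) :
    red u hu = ⇑(patt π I hI) := by
  subst h
  funext i
  exact red_eq_symm_apply _ hu (I.image ⇑π)
    (by rw [Finset.card_image_of_injective _ π.injective, hI])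
    (by rw [← Finset.image_image, image_hmap]) i
    (Finset.mem_image_of_mem _ (I.orderIsoOfFin hI i).2)

theorem patt_congr {ℓ n : ℕ} {π σ : Equiv.Perm (Fin n)} {I : Finset (Fin n)} {hI : I.card = ℓ}
    (h : ⇑π ∘ hmap I hI = ⇑σ ∘ hmap I hI) : patt π I hI = patt σ I hI := by
  have hu : Function.Injective (⇑π ∘ hmap I hI) := π.injective.comp (hmap_injective I hI)
  exact DFunLike.coe_injective
    ((red_comp_hmap π I hI _ hu rfl).symm.trans (red_comp_hmap σ I hI _ hu h))

/-- `red (ρ_J)` consists of the patterns at `J` of members of `H`. -/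
theorem mem_redSet_orbitRel_iff {ℓ n : ℕ} {H : Subgroup (Equiv.Perm (Fin n))}
    {J : Finset (Fin n)} {hJ : J.card = ℓ} {v : Fin ℓ → Fin ℓ} :
    v ∈ redSet (orbitRel H (hmap J hJ)) ↔ ∃ σ ∈ H, v = ⇑(patt σ J hJ) := by
  constructor
  · rintro ⟨r, ⟨σ, hσ, hr⟩, hinj, rfl⟩
    exact ⟨σ, hσ, red_comp_hmap σ J hJ r hinj hr⟩
  · rintro ⟨σ, hσ, rfl⟩
    have hinj := σ.injective.comp (hmap_injective J hJ)
    exact ⟨_, ⟨σ, hσ, rfl⟩, hinj, (red_comp_hmap σ J hJ _ hinj rfl).symm⟩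

theorem preserves_orbitRel_of_mem {ℓ n : ℕ} {H : Subgroup (Equiv.Perm (Fin n))}
    {π : Equiv.Perm (Fin n)} (hπ : π ∈ H) (a : Fin ℓ → Fin n) :
    Preserves ⇑π (orbitRel H a) := by
  rintro r ⟨σ, hσ, rfl⟩
  exact ⟨π * σ, H.mul_mem hπ hσ, rfl⟩

/-- A map that agrees on every `ℓ`-subset with some member of `H` preserves all
relations `ρ_I`. -/
theorem preserves_orbitRel_of_forall_comp_hmap_mem {ℓ n : ℕ} {H : Subgroup (Equiv.Perm (Fin n))}
    {f : Fin n → Fin n}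
    (h : ∀ (I : Finset (Fin n)) (hI : I.card = ℓ), f ∘ hmap I hI ∈ orbitRel H (hmap I hI))
    (I : Finset (Fin n)) (hI : I.card = ℓ) : Preserves f (orbitRel H (hmap I hI)) := by
  rintro r ⟨σ, hσ, rfl⟩
  have hK : (I.image ⇑σ).card = ℓ := by rw [Finset.card_image_of_injective _ σ.injective, hI]
  obtain ⟨τ, hτ, hfτ⟩ := h (I.image ⇑σ) hK
  refine ⟨τ * σ, H.mul_mem hτ hσ, funext fun i => ?_⟩
  have hi : σ (hmap I hI i) ∈ I.image ⇑σ :=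
    Finset.mem_image_of_mem _ (I.orderIsoOfFin hI i).2
  simpa [hmap] using congrFun hfτ (((I.image ⇑σ).orderIsoOfFin hK).symm ⟨_, hi⟩)

/-- Theorem 4.2: `H ≤ S_n` is of the form `Comp^n(S)` for some `S ⊆ S_ℓ` iff
(a) `H = Aut {ρ_I : I}` where `ρ_I = (h_I)^H`, and (b) for every tuple
`x ∈ [n]^n` with pairwise distinct entries: if every `ℓ`-pattern `red(x ∘ h_I)` lies in
some `red(ρ_J)`, then `x ∘ h_I ∈ ρ_I` for every `I`. -/
theorem stmt11 (ℓ n : ℕ) (hℓ : 0 < ℓ) (hn : ℓ ≤ n) (H : Subgroup (Equiv.Perm (Fin n))) :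
    (∃ S : Set (Equiv.Perm (Fin ℓ)), (H : Set (Equiv.Perm (Fin n))) = CompSet n S) ↔
      ((H : Set (Equiv.Perm (Fin n))) =
        {π : Equiv.Perm (Fin n) | ∀ (I : Finset (Fin n)) (hI : I.card = ℓ),
          Preserves ⇑π (orbitRel H (hmap I hI))} ∧
      ∀ (x : Fin n → Fin n) (hx : Function.Injective x),
        (∀ (I : Finset (Fin n)) (hI : I.card = ℓ),
          ∃ (J : Finset (Fin n)) (hJ : J.card = ℓ),
            red (x ∘ hmap I hI) (hx.comp (hmap_injective I hI)) ∈
              redSet (orbitRel H (hmap J hJ))) →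
        ∀ (I : Finset (Fin n)) (hI : I.card = ℓ),
          x ∘ hmap I hI ∈ orbitRel H (hmap I hI)) := by
  constructor
  · rintro ⟨S, hS⟩
    have mem_iff : ∀ τ : Equiv.Perm (Fin n), τ ∈ H ↔ PattSet ℓ τ ⊆ S := fun τ => by
      rw [← SetLike.mem_coe, hS]; rfl
    refine ⟨Set.Subset.antisymm (fun π hπ I hI => preserves_orbitRel_of_mem hπ _) ?_, ?_⟩
    · intro π hπ
      refine (mem_iff π).2 ?_
      rintro _ ⟨I, hI, rfl⟩
      obtain ⟨σ, hσ, hπσ⟩ := hπ I hI (hmap I hI) ⟨1, H.one_mem, rfl⟩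
      rw [patt_congr hπσ]
      exact (mem_iff σ).1 hσ ⟨I, hI, rfl⟩
    · intro x hx hred I hI
      obtain ⟨π, rfl⟩ : ∃ π : Equiv.Perm (Fin n), ⇑π = x :=
        ⟨Equiv.ofBijective x (Finite.injective_iff_bijective.1 hx), rfl⟩
      refine ⟨π, (mem_iff π).2 ?_, rfl⟩
      rintro _ ⟨K, hK, rfl⟩
      obtain ⟨J, hJ, hmem⟩ := hred K hK
      obtain ⟨σ, hσ, hv⟩ := mem_redSet_orbitRel_iff.1 hmem
      rw [DFunLike.coe_injective ((red_comp_hmap π K hK _ _ rfl).symm.trans hv)]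
      exact (mem_iff σ).1 hσ ⟨J, hJ, rfl⟩
  · rintro ⟨hAut, hred⟩
    refine ⟨⋃ τ ∈ H, PattSet ℓ τ, Set.Subset.antisymm
      (fun π hπ => Set.subset_biUnion_of_mem (u := fun τ => PattSet ℓ τ) hπ) ?_⟩
    intro τ hτ
    rw [hAut]
    refine preserves_orbitRel_of_forall_comp_hmap_mem (hred τ τ.injective fun I hI => ?_)
    obtain ⟨σ, hσ, J, hJ, hpatt⟩ := Set.mem_iUnion₂.1 (hτ ⟨I, hI, rfl⟩)
    exact ⟨J, hJ, mem_redSet_orbitRel_iff.2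
      ⟨σ, hσ, by rw [red_comp_hmap τ I hI _ _ rfl, hpatt]⟩⟩
end

section
/- Let k ≤ ℓ ≤ n be positive integers and let σ ⊆ [ℓ]^k be a k-ary relation on [ℓ] whose tuples have pairwise distinct entries. Then Comp^n(Aut σ) ⊆ Aut σ̂; that is, every permutation of [n] all of whose ℓ-patterns preserve σ itself preserves σ̂. -/
open Equiv Finset Function

/-- The defining identity `h_{π(I)} ∘ π_I = π ∘ h_I` of the pattern `π_I`. -/
theorem hmap_comp_patt {ℓ n : ℕ} (π : Equiv.Perm (Fin n)) (I : Finset (Fin n))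
    (hI : I.card = ℓ) (hI' : (I.image ⇑π).card = ℓ) :
    hmap (I.image ⇑π) hI' ∘ patt π I hI = π ∘ hmap I hI := by
  funext i
  exact congrArg Subtype.val (((I.image ⇑π).orderIsoOfFin hI').apply_symm_apply _)

/-- Lemma 5.5: for `σ ⊆ [ℓ]^k_≠` (`k ≤ ℓ ≤ n`): `Comp^n(Aut σ) ⊆ Aut σ̂`. -/
theorem stmt16 (k ℓ n : ℕ) (hk : 0 < k) (hkl : k ≤ ℓ) (hln : ℓ ≤ n)
    (σ : Set (Fin k → Fin ℓ)) (hσ : ∀ s ∈ σ, Function.Injective s) :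
    CompSet n {g : Equiv.Perm (Fin ℓ) | Preserves ⇑g σ} ⊆
      {π : Equiv.Perm (Fin n) | Preserves ⇑π (hatRel n σ)} := by
  rintro π hπ _ ⟨s, hs, J, hJ, rfl⟩
  have hJ' : (J.image ⇑π).card = ℓ := by
    rw [Finset.card_image_of_injective _ π.injective, hJ]
  refine ⟨patt π J hJ ∘ s, hπ ⟨J, hJ, rfl⟩ s hs, J.image ⇑π, hJ', ?_⟩
  rw [← Function.comp_assoc, ← Function.comp_assoc, hmap_comp_patt π J hJ hJ']
end
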